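/- Let R be a finite local principal ideal ring of length two with residue field F_q, and let F(t) ∈ R[t] be a monic polynomial of degree d with irreducible reduction f ∈ F_q[t]. Let J be the rd × rd block matrix with r diagonal blocks equal to the companion matrix C_F and identity blocks on the subdiagonal. Then the centralizer of J in GL_{rd}(R) has order |m|^{rd} · q^{d(r−1)} · (q^d − 1). -/

import Mathlib

open Polynomial IsLocalRing Matrix

/-- The companion matrix of a monic polynomial of degree `d`. -/
def companionMatrix {R : Type*} [CommRing R] (d : ℕ) (F : Polynomial R) :
    Matrix (Fin d) (Fin d) R :=
  Matrix.of fun i j =>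
    if (j : ℕ) = d - 1 then -F.coeff i
    else if (i : ℕ) = (j : ℕ) + 1 then 1 else 0

/-- The block matrix `J_{R,F}(r)`: `r` diagonal blocks equal to the companion matrix
`C_F` and identity blocks on the subdiagonal. -/
def jordanBlockMatrix {R : Type*} [CommRing R] (r d : ℕ) (F : Polynomial R) :
    Matrix (Fin r × Fin d) (Fin r × Fin d) R :=
  Matrix.of fun i j =>
    if i.1 = j.1 then companionMatrix d F i.2 j.2
    else if (i.1 : ℕ) = (j.1 : ℕ) + 1 then (if i.2 = j.2 then 1 else 0)
    else 0


theorem aux_nil {R : Type*} [CommRing R] [IsLocalRing R] (hm2 : (maximalIdeal R) ^ 2 = ⊥)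
    {S : Type*} [CommRing S] [Algebra R S] (p : R[X]) (hp : p.map (residue R) = 0) (x : S) :
    IsNilpotent (aeval x p) := by
  have : IsNilpotent p := by
    rw [Polynomial.isNilpotent_iff]
    intro i
    refine ⟨2, ?_⟩
    have h1 : p.coeff i ∈ maximalIdeal R := by
      have := congrArg (fun z => z.coeff i) hp
      simpa [Polynomial.coeff_map, residue_eq_zero_iff] using this
    have := Ideal.pow_mem_pow h1 2
    rw [hm2] at this
    simpa using this
  exact this.map (aeval x)

theorem aux_root_nil {R B : Type*} [CommRing R] [CommRing B] [Algebra R B] (F : R[X]) (θ s : B)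
    (hθ : aeval θ F = 0) (hs : IsNilpotent s) : IsNilpotent (aeval (θ + s) F) := by
  have h := Polynomial.sub_dvd_eval_sub (θ + s) θ (F.map (algebraMap R B))
  simp only [eval_map_algebraMap, hθ, add_sub_cancel_left, sub_zero] at h
  obtain ⟨c, hc⟩ := h
  rw [hc]
  exact (Commute.all _ _).isNilpotent_mul_right hs

/-- derivative at an approximate root is a unit -/
theorem aux_deriv_unit {R : Type*} [CommRing R] [IsLocalRing R] [Finite R]
    (hm2 : (maximalIdeal R) ^ 2 = ⊥) (F : R[X]) 
    (hirr : Irreducible (F.map (residue R)))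
    {S : Type*} [CommRing S] [Algebra R S] (x : S) (hx : IsNilpotent (aeval x F)) :
    IsUnit (aeval x (derivative F)) := by
  have : Finite (ResidueField R) := Finite.of_surjective _ (residue_surjective (R := R))
  have hsep : (F.map (residue R)).Separable := PerfectField.separable_of_irreducible hirr
  obtain ⟨a, b, hab⟩ := hsep
  obtain ⟨a, rfl⟩ := Polynomial.map_surjective _ (residue_surjective (R := R)) a
  obtain ⟨b, rfl⟩ := Polynomial.map_surjective _ (residue_surjective (R := R)) b
  have h := aux_nil hm2 (a * F + b * derivative F - 1)
    (by simp only [Polynomial.map_sub, Polynomial.map_add, Polynomial.map_mul, Polynomial.map_one,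
        ← Polynomial.derivative_map, hab, sub_self]) x
  have h2 : IsNilpotent (aeval x (a * F + b * derivative F - 1) - aeval x a * aeval x F) :=
    (Commute.all _ _).isNilpotent_sub h ((Commute.all _ _).isNilpotent_mul_left hx)
  have h3 := h2.isUnit_one_add
  have : 1 + (aeval x (a * F + b * derivative F - 1) - aeval x a * aeval x F)
      = aeval x b * aeval x (derivative F) := by
    simp only [map_sub, map_add, map_mul, map_one]; ring
  rw [this] at h3
  exact isUnit_of_mul_isUnit_right h3

theorem aux_mem {R : Type*} [CommRing R] [IsLocalRing R] [Finite R]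
    (hm2 : (maximalIdeal R) ^ 2 = ⊥) (F : R[X]) 
    (hirr : Irreducible (F.map (residue R)))
    {B : Type*} [CommRing B] [Algebra R B] (θ s : B) (hθ : aeval θ F = 0) (hs : IsNilpotent s) :
    θ ∈ Algebra.adjoin R {θ + s} := by
  set S := Algebra.adjoin R {θ + s}
  let t : S := ⟨θ + s, Algebra.subset_adjoin rfl⟩
  have hinj : Function.Injective S.val := Subtype.val_injective
  have hv : ∀ p : R[X], ∀ y : S, S.val (aeval y p) = aeval (S.val y) p := fun p y =>
    (Polynomial.aeval_algHom_apply S.val y p).symm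
  have hnB := aux_root_nil F θ s hθ hs
  have hn : IsNilpotent (aeval t F) := by
    rw [← IsNilpotent.map_iff hinj, hv]; exact hnB
  obtain ⟨y, ⟨hy1, hy2⟩, -⟩ := Polynomial.existsUnique_nilpotent_sub_and_aeval_eq_zero hn
    (aux_deriv_unit hm2 F hirr t hn)
  have hu := (Polynomial.existsUnique_nilpotent_sub_and_aeval_eq_zero hnB
    (aux_deriv_unit hm2 F hirr (θ + s) hnB)).unique (y₁ := θ) (y₂ := S.val y)
    ⟨by simpa using hs, hθ⟩ ⟨by
      have := hy1.map S.val
      simpa [t] using this, by rw [← hv, hy2, map_zero]⟩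
  rw [hu]; exact y.2

theorem aux_centralizer {R B ι : Type*} [CommRing R] [CommRing B] [Algebra R B] [Fintype ι]
    [DecidableEq ι] (b : Module.Basis ι R B) (τ : B) (hτ : Algebra.adjoin R {τ} = ⊤)
    (X : Matrix ι ι R) (hX : X * Algebra.leftMulMatrix b τ = Algebra.leftMulMatrix b τ * X) :
    ∃ y, Algebra.leftMulMatrix b y = X := by
  set T := Matrix.toLin b b X with hT
  have hL : ∀ y x : B, Matrix.toLin b b (Algebra.leftMulMatrix b y) x = y * x := by
    intro y x
    rw [Algebra.leftMulMatrix_apply, Matrix.toLin_toMatrix]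
    rfl
  have h1 : ∀ x, T (τ * x) = τ * T x := by
    intro x
    have := congrArg (fun Z => Matrix.toLin b b Z x) hX
    simpa [Matrix.toLin_mul b b b, hL] using this
  have h2 : ∀ y x, T (y * x) = y * T x := by
    intro y
    have hy : y ∈ Algebra.adjoin R {τ} := hτ ▸ trivial
    induction hy using Algebra.adjoin_induction with
    | mem y hy => rw [Set.mem_singleton_iff.1 hy]; exact h1
    | algebraMap c => intro x; simp [← Algebra.smul_def]
    | add u v _ _ hu hv => intro x; simp [add_mul, hu, hv]
    | mul u v _ _ hu hv => intro x; simp [mul_assoc, hu, hv]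
  refine ⟨T 1, ?_⟩
  apply (Matrix.toLin b b).injective
  ext x
  have := h2 x 1
  rw [mul_one, mul_comm] at this
  rw [hL]
  exact this.symm

theorem aux_card {R B ι : Type*} [CommRing R] [CommRing B] [Algebra R B] [Fintype ι]
    [DecidableEq ι] (b : Module.Basis ι R B) (τ : B) (hτ : Algebra.adjoin R {τ} = ⊤) :
    Nat.card {X : Matrix ι ι R //
      IsUnit X ∧ X * Algebra.leftMulMatrix b τ = Algebra.leftMulMatrix b τ * X} =
    Nat.card {y : B // IsUnit y} := by
  symm
  refine Nat.card_congr (Equiv.ofBijective (fun y => ⟨Algebra.leftMulMatrix b y.1,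
    y.2.map _, by rw [← map_mul, ← map_mul, mul_comm]⟩) ⟨?_, ?_⟩)
  · intro y z h
    exact Subtype.ext (Algebra.leftMulMatrix_injective b (congrArg Subtype.val h))
  · rintro ⟨X, hu, hX⟩
    obtain ⟨u, rfl⟩ := hu
    obtain ⟨y, hy⟩ := aux_centralizer b τ hτ _ hX
    obtain ⟨z, hz⟩ := aux_centralizer b τ hτ (↑u⁻¹ : Matrix ι ι R)
      (Commute.units_inv_left (u := u) (show Commute _ _ from hX))
    have : y * z = 1 := by
      apply Algebra.leftMulMatrix_injective b
      rw [map_mul, hy, hz, map_one, Units.mul_inv]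
    exact ⟨⟨y, IsUnit.of_mul_eq_one _ this⟩, Subtype.ext hy⟩

theorem aux_units {B K : Type*} [CommRing B] [Finite B] [Field K] (φ : B →+* K)
    (hφ : Function.Surjective φ) (hker : ∀ x, φ x = 0 → IsNilpotent x) :
    Nat.card {y : B // IsUnit y} * Nat.card K = Nat.card B * (Nat.card K - 1) := by
  have : Finite K := Finite.of_surjective _ hφ
  have hiff : ∀ y, IsUnit y ↔ ¬ (y ∈ RingHom.ker φ) := by
    intro y
    constructor
    · intro h h0
      have := h.map φ
      rw [(RingHom.mem_ker).1 h0] at this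
      exact not_isUnit_zero this
    · intro h
      rw [RingHom.mem_ker] at h
      obtain ⟨z, hz⟩ := hφ (φ y)⁻¹
      have hn := hker (y * z - 1) (by simp [hz, h])
      have := hn.isUnit_one_add
      rw [add_sub_cancel] at this
      exact isUnit_of_mul_isUnit_left this
  have e1 : Nat.card {y : B // IsUnit y} + Nat.card (RingHom.ker φ) = Nat.card B := by
    rw [Nat.card_congr (Equiv.subtypeEquivRight hiff), add_comm]
    classical
    rw [← Nat.card_congr (Equiv.sumCompl (fun y => y ∈ RingHom.ker φ)), Nat.card_sum]
  have e2 : Nat.card B = Nat.card (RingHom.ker φ) * Nat.card K := by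
    rw [← Nat.card_congr (RingHom.quotientKerEquivOfSurjective hφ).toEquiv]
    exact Submodule.card_eq_card_quotient_mul_card (RingHom.ker φ) |>.trans rfl
  have hK : 0 < Nat.card K := Nat.card_pos
  obtain ⟨n, hn⟩ := Nat.exists_eq_succ_of_ne_zero hK.ne'
  rw [hn] at e2 ⊢
  have : Nat.card {y : B // IsUnit y} = Nat.card (RingHom.ker φ) * n := by
    rw [e2] at e1; simp [Nat.mul_succ] at e1; exact e1
  rw [this, e2]; simp; ring

theorem aux_matrix {R B : Type*} [CommRing R] [CommRing B] [Algebra R B] (r d : ℕ) (F : R[X])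
    (hF : F.Monic) (hd : F.natDegree = d) (θ s : B) (hθ : aeval θ F = 0) (hs : s ^ r = 0)
    (b : Module.Basis (Fin r × Fin d) R B) (hb : ∀ i j, b (i, j) = s ^ (i : ℕ) * θ ^ (j : ℕ)) :
    Algebra.leftMulMatrix b (θ + s) = jordanBlockMatrix r d F := by
  have hθd : θ ^ d = - ∑ k : Fin d, F.coeff k • θ ^ (k : ℕ) := by
    rw [aeval_eq_sum_range, hd, Finset.sum_range_succ, Finset.sum_range] at hθ
    have : F.coeff d = 1 := by rw [← hd]; exact hF
    rw [this, one_smul] at hθ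
    exact eq_neg_of_add_eq_zero_right hθ
  ext ⟨i', j'⟩ ⟨i, j⟩
  rw [Algebra.leftMulMatrix_eq_repr_mul, hb]
  have e : (θ + s) * (s ^ (i : ℕ) * θ ^ (j : ℕ)) =
      s ^ (i : ℕ) * θ ^ ((j : ℕ) + 1) + s ^ ((i : ℕ) + 1) * θ ^ (j : ℕ) := by ring
  rw [e, map_add, Finsupp.add_apply]
  have p1 : b.repr (s ^ ((i : ℕ) + 1) * θ ^ (j : ℕ)) (i', j') =
      if (i' : ℕ) = (i : ℕ) + 1 then (if j' = j then 1 else 0) else 0 := by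
    by_cases h : (i : ℕ) + 1 < r
    · have := hb ⟨(i : ℕ) + 1, h⟩ j
      simp only at this
      rw [← this, Module.Basis.repr_self, Finsupp.single_apply]
      simp only [Prod.mk.injEq, Fin.ext_iff]
      split_ifs <;> first | rfl | omega
    · have h2 : (i : ℕ) + 1 = r := by omega
      rw [h2, hs, zero_mul, map_zero, if_neg (by omega)]
      rfl
  have p2 : b.repr (s ^ (i : ℕ) * θ ^ ((j : ℕ) + 1)) (i', j') =
      if i' = i then companionMatrix d F j' j else 0 := by
    unfold companionMatrix
    rw [Matrix.of_apply]
    by_cases h : (j : ℕ) + 1 < d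
    · have := hb i ⟨(j : ℕ) + 1, h⟩
      simp only at this
      rw [← this, Module.Basis.repr_self, Finsupp.single_apply]
      simp only [Prod.mk.injEq, Fin.ext_iff]
      split_ifs <;> first | rfl | omega
    · have h2 : (j : ℕ) + 1 = d := by omega
      have h3 : s ^ (i : ℕ) * θ ^ d = - ∑ k : Fin d, F.coeff k • b (i, k) := by
        rw [hθd, mul_neg, Finset.mul_sum]
        congr 1
        refine Finset.sum_congr rfl fun k _ => ?_
        rw [hb, mul_smul_comm]
      rw [h2, h3, if_pos (show (j : ℕ) = d - 1 by omega), map_neg, map_sum]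
      simp only [map_smul, Module.Basis.repr_self, Finsupp.neg_apply, Finsupp.finsetSum_apply,
        Finsupp.smul_apply, Finsupp.single_apply, Prod.mk.injEq, smul_eq_mul]
      by_cases hi : i' = i
      · subst hi; simp
      · simp [hi, Ne.symm hi]
  rw [p1, p2]
  unfold jordanBlockMatrix
  rw [Matrix.of_apply]
  simp only
  by_cases hi : i' = i
  · subst hi; simp
  · simp [hi]

/-- Let `R` be a finite local principal ideal ring of length two with maximal ideal `m`
and residue field of order `q`, and let `F ∈ R[t]` be monic of degree `d` with
irreducible reduction.  Then the centralizer of `J = J_{R,F}(r)` in `GL_{rd}(R)` has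
order `|m|^{rd} · q^{d(r−1)} · (q^d − 1)`. -/
theorem card_centralizer_jordanBlock
    (R : Type*) [CommRing R] [IsLocalRing R] [Finite R]
    (hprin : (maximalIdeal R).IsPrincipal)
    (hm2 : (maximalIdeal R) ^ 2 = ⊥)
    (r d : ℕ) (hr : 0 < r)
    (F : Polynomial R) (hF : F.Monic) (hd : F.natDegree = d)
    (hirr : Irreducible (F.map (residue R))) :
    Nat.card {X : Matrix (Fin r × Fin d) (Fin r × Fin d) R //
        IsUnit X ∧ X * jordanBlockMatrix r d F = jordanBlockMatrix r d F * X} =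
      Nat.card (maximalIdeal R) ^ (r * d) *
        (Nat.card (ResidueField R) ^ (d * (r - 1)) *
          (Nat.card (ResidueField R) ^ d - 1)) := by
  have hfk : Finite (ResidueField R) := Finite.of_surjective _ (residue_surjective (R := R))
  let A := AdjoinRoot F
  have hA : Nontrivial A := by
    have hpos : 0 < F.natDegree := by
      rw [← hF.natDegree_map (residue R)]
      exact hirr.natDegree_pos
    refine Ideal.Quotient.nontrivial_iff.2 fun h => ?_
    rw [Ideal.span_singleton_eq_top] at h
    rw [hF.eq_one_of_isUnit h] at hpos
    simp at hpos
  let G : A[X] := X ^ r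
  have hG : G.Monic := monic_X_pow r
  have hGr : G.natDegree = r := natDegree_X_pow r
  let B := AdjoinRoot G
  let bA := (AdjoinRoot.powerBasisAux' hF).reindex (finCongr hd)
  let bB := (AdjoinRoot.powerBasisAux' hG).reindex (finCongr hGr)
  have hbA : ∀ j, bA j = AdjoinRoot.root F ^ (j : ℕ) := by
    intro j
    rw [Module.Basis.reindex_apply]
    exact (AdjoinRoot.powerBasis' hF).basis_eq_pow _
  have hbB : ∀ i, bB i = AdjoinRoot.root G ^ (i : ℕ) := by
    intro j
    rw [Module.Basis.reindex_apply]
    exact (AdjoinRoot.powerBasis' hG).basis_eq_pow _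
  let b : Module.Basis (Fin r × Fin d) R B := bA.smulTower' bB
  let θ : B := algebraMap A B (AdjoinRoot.root F)
  let s : B := AdjoinRoot.root G
  have hb : ∀ i j, b (i, j) = s ^ (i : ℕ) * θ ^ (j : ℕ) := by
    intro i j
    rw [Module.Basis.smulTower'_apply, hbA, hbB, Algebra.smul_def, map_pow, mul_comm]
  have hθ : aeval θ F = 0 := by
    rw [aeval_algebraMap_apply]
    have : aeval (AdjoinRoot.root F) F = 0 := by rw [AdjoinRoot.aeval_eq, AdjoinRoot.mk_self]
    rw [this, map_zero]
  have hs : s ^ r = 0 := by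
    have : AdjoinRoot.mk G (X ^ r) = 0 := AdjoinRoot.mk_self
    simpa using this
  have hsn : IsNilpotent s := ⟨r, hs⟩
  have hmem := aux_mem hm2 F hirr θ s hθ hsn
  have htop : Algebra.adjoin R {θ + s} = ⊤ := by
    have hs' : s ∈ Algebra.adjoin R {θ + s} := by
      have := sub_mem (Algebra.subset_adjoin (R := R) (Set.mem_singleton (θ + s))) hmem
      simpa using this
    rw [eq_top_iff]
    intro x _
    rw [← b.sum_repr x]
    refine sum_mem fun ij _ => Subalgebra.smul_mem _ ?_ _
    obtain ⟨i, j⟩ := ij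
    rw [hb]
    exact mul_mem (pow_mem hs' _) (pow_mem hmem _)
  rw [← aux_matrix r d F hF hd θ s hθ hs b hb, aux_card b (θ + s) htop]
  let f := F.map (residue R)
  have hfact : Fact (Irreducible f) := ⟨hirr⟩
  let K := AdjoinRoot f
  let ι : R →+* K := (AdjoinRoot.of f).comp (residue R)
  let φA : A →+* K := AdjoinRoot.lift ι (AdjoinRoot.root f) (by
    rw [← Polynomial.eval₂_map]; exact AdjoinRoot.eval₂_root f)
  let φ : B →+* K := AdjoinRoot.lift φA 0 (by simp [G, hr.ne'])
  have hφR : ∀ c : R, φ (algebraMap R B c) = ι c := by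
    intro c
    rw [IsScalarTower.algebraMap_apply R A B]
    exact (AdjoinRoot.lift_of _).trans (AdjoinRoot.lift_of _)
  have hφτ : φ (θ + s) = AdjoinRoot.root f := by
    have h1 : φ θ = AdjoinRoot.root f := (AdjoinRoot.lift_of _).trans (AdjoinRoot.lift_root _)
    have h2 : φ s = 0 := AdjoinRoot.lift_root _
    rw [map_add, h1, h2, add_zero]
  have hφp : ∀ p : R[X], φ (aeval (θ + s) p) = AdjoinRoot.mk f (p.map (residue R)) := by
    intro p
    rw [aeval_def, Polynomial.hom_eval₂, hφτ, ← AdjoinRoot.aeval_eq, aeval_def,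
      Polynomial.eval₂_map]
    congr 1
    ext c
    exact hφR c
  have hsurj : Function.Surjective φ := by
    intro y
    obtain ⟨p, rfl⟩ := AdjoinRoot.mk_surjective y
    obtain ⟨p, rfl⟩ := Polynomial.map_surjective _ (residue_surjective (R := R)) p
    exact ⟨_, hφp p⟩
  have hFn := aux_root_nil F θ s hθ hsn
  have hker : ∀ x, φ x = 0 → IsNilpotent x := by
    intro x hx
    have hx' : x ∈ Algebra.adjoin R {θ + s} := htop ▸ trivial
    rw [Algebra.adjoin_singleton_eq_range_aeval] at hx'
    obtain ⟨p, rfl⟩ := hx'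
    change φ (aeval (θ + s) p) = 0 at hx
    rw [hφp, AdjoinRoot.mk_eq_zero] at hx
    obtain ⟨g, hg⟩ := hx
    obtain ⟨g, rfl⟩ := Polynomial.map_surjective _ (residue_surjective (R := R)) g
    have h1 := aux_nil hm2 (p - F * g) (by
      rw [Polynomial.map_sub, hg, Polynomial.map_mul, sub_self]) (θ + s)
    have h2 := (Commute.all _ _).isNilpotent_add h1
      ((Commute.all (aeval (θ + s) F) (aeval (θ + s) g)).isNilpotent_mul_right hFn)
    rw [map_sub, map_mul, sub_add_cancel] at h2
    exact h2
  have hBcard : Nat.card B = Nat.card R ^ (r * d) := by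
    rw [Nat.card_congr b.equivFun.toEquiv, Nat.card_fun]
    simp
  have hBfin : Finite B := Finite.of_equiv _ b.equivFun.toEquiv.symm
  have hKcard : Nat.card K = Nat.card (ResidueField R) ^ d := by
    have hf : f.Monic := hF.map _
    rw [Nat.card_congr (AdjoinRoot.powerBasisAux' hf).equivFun.toEquiv, Nat.card_fun]
    have : f.natDegree = d := by rw [← hd]; exact hF.natDegree_map _
    simp [this]
  have hRcard : Nat.card R = Nat.card (maximalIdeal R) * Nat.card (ResidueField R) := by
    exact Submodule.card_eq_card_quotient_mul_card (maximalIdeal R)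
  have hmain := aux_units φ hsurj hker
  rw [hBcard, hKcard, hRcard] at hmain
  have hq : 0 < Nat.card (ResidueField R) ^ d := pow_pos Nat.card_pos _
  apply Nat.eq_of_mul_eq_mul_right hq
  rw [hmain]
  have : Nat.card (ResidueField R) ^ (r * d) =
      Nat.card (ResidueField R) ^ (d * (r - 1)) * Nat.card (ResidueField R) ^ d := by
    rw [← pow_add]
    congr 1
    obtain ⟨n, rfl⟩ := Nat.exists_eq_succ_of_ne_zero hr.ne'
    simp; ring
  rw [mul_pow, this]
  ring
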